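/- arXiv:1609.07776 — 5 statements merged into one kernel-verified Lean document; each statement's English description precedes it below -/
import Mathlib

section
/- Let A and B be C*-algebras with A unital, and let T : A → B be a linear map which is a *-homomorphism at the unit of A. Then T is continuous, and T(a) T(1) = T(1) T(a) = T(a) for every a ∈ A. -/
/-- A map `T` between C*-algebras is a `*`-homomorphism at the point `z` if
`a * b* = z` implies `T (a * b*) = T a * (T b)* = T z` and
`c* * d = z` implies `T (c* * d) = (T c)* * T d = T z`. -/
def IsStarHomAt {A B : Type*} [Mul A] [Star A] [Mul B] [Star B]
    (T : A → B) (z : A) : Prop :=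
  (∀ a b : A, a * star b = z →
      T (a * star b) = T a * star (T b) ∧ T a * star (T b) = T z) ∧
  (∀ c d : A, star c * d = z →
      T (star c * d) = star (T c) * T d ∧ star (T c) * T d = T z)

section StarHomAtOne

variable {A B : Type*}

lemma isSelfAdjoint_of_mul_star_eq_self [Mul B] [StarMul B] {p : B} (hp : p * star p = p) :
    IsSelfAdjoint p :=
  hp ▸ IsSelfAdjoint.mul_star_self p

section CStarRing

variable [NonUnitalNormedRing B] [StarRing B] [CStarRing B]

lemma mul_eq_self_of_star_mul_self_eq {p w : B} (hp : p * star p = p) (hw : star w * w = p) :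
    w * p = w := by
  have hs : star p = p := isSelfAdjoint_of_mul_star_eq_self hp
  have hpp : p * p = p := by rwa [hs] at hp
  rw [← sub_eq_zero, ← CStarRing.star_mul_self_eq_zero_iff]
  have h1 : star w * (w * p) = p := by rw [← mul_assoc, hw, hpp]
  simp [sub_mul, mul_sub, hs, mul_assoc, h1, hw, hpp]

lemma mul_eq_self_of_mul_star_self_eq {p w : B} (hp : p * star p = p) (hw : w * star w = p) :
    p * w = w := by
  have hs : star p = p := isSelfAdjoint_of_mul_star_eq_self hp
  simpa [hs] using congrArg star (mul_eq_self_of_star_mul_self_eq (w := star w) hp (by simpa))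

lemma norm_le_one_of_mul_star_eq_self {p : B} (hp : p * star p = p) : ‖p‖ ≤ 1 := by
  have h := CStarRing.norm_self_mul_star (x := p)
  rw [hp] at h
  nlinarith [norm_nonneg p]

lemma norm_le_one_of_star_mul_self_eq {p w : B} (hp : p * star p = p) (hw : star w * w = p) :
    ‖w‖ ≤ 1 := by
  have h := CStarRing.norm_star_mul_self (x := w)
  rw [hw] at h
  nlinarith [norm_nonneg w, norm_le_one_of_mul_star_eq_self hp]

end CStarRing

/-- A linear map out of a unital C*-algebra that is contractive on unitaries is continuous. -/
lemma LinearMap.continuous_of_norm_unitary_le_one [CStarAlgebra A] [SeminormedAddCommGroup B]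
    [NormedSpace ℂ B] (T : A →ₗ[ℂ] B) (hT : ∀ u ∈ unitary A, ‖T u‖ ≤ 1) : Continuous T := by
  refine AddMonoidHomClass.continuous_of_bound T 2 fun x ↦ ?_
  obtain ⟨u, c, hx, hc⟩ := CStarAlgebra.exists_sum_four_unitary x
  calc ‖T x‖ = ‖∑ i, c i • T (u i)‖ := by rw [congrArg T hx, map_sum]; simp only [map_smul]
    _ ≤ ∑ i, ‖c i • T (u i)‖ := norm_sum_le _ _
    _ ≤ ∑ _i : Fin 4, ‖x‖ / 2 := by
      refine Finset.sum_le_sum fun i _ ↦ ?_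
      rw [norm_smul]
      exact (mul_le_of_le_one_right (norm_nonneg _) (hT _ (u i).2)).trans (hc i)
    _ = 2 * ‖x‖ := by simp; ring

end StarHomAtOne

theorem stmt2 {A B : Type*}
    [NormedRing A] [StarRing A] [CStarRing A] [CompleteSpace A]
    [NormedAlgebra ℂ A] [StarModule ℂ A]
    [NonUnitalNormedRing B] [StarRing B] [CStarRing B] [CompleteSpace B]
    [NormedSpace ℂ B] [IsScalarTower ℂ B B] [SMulCommClass ℂ B B] [StarModule ℂ B]
    (T : A →ₗ[ℂ] B)
    (h : IsStarHomAt (⇑T) 1) :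
    Continuous T ∧ ∀ a : A, T a * T 1 = T a ∧ T 1 * T a = T a := by
  let _ : CStarAlgebra A := {}
  have hp : T 1 * star (T 1) = T 1 := (h.1 1 1 (by simp)).2
  have hl : ∀ u ∈ unitary A, star (T u) * T u = T 1 := fun u hu ↦
    (h.2 u u (Unitary.star_mul_self_of_mem hu)).2
  have hr : ∀ u ∈ unitary A, T u * star (T u) = T 1 := fun u hu ↦
    (h.1 u u (Unitary.mul_star_self_of_mem hu)).2
  refine ⟨T.continuous_of_norm_unitary_le_one fun u hu ↦
    norm_le_one_of_star_mul_self_eq hp (hl u hu), fun a ↦ ?_⟩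
  have ha : a ∈ Submodule.span ℂ (unitary A : Set A) := by
    simp [CStarAlgebra.span_unitary]
  induction ha using Submodule.span_induction with
  | mem u hu =>
    exact ⟨mul_eq_self_of_star_mul_self_eq hp (hl u hu),
      mul_eq_self_of_mul_star_self_eq hp (hr u hu)⟩
  | zero => simp
  | add x y _ _ hx hy => simp [add_mul, mul_add, hx.1, hx.2, hy.1, hy.2]
  | smul c x _ hx => simp [smul_mul_assoc, mul_smul_comm, hx.1, hx.2]
end

section
/- Let A and B be C*-algebras, where A is unital, simple and infinite; that is, every closed two-sided ideal of A is either {0} or A, and there exists v ∈ A with v* v = 1 and v v* ≠ 1. Then a linear map T : A → B is a *-homomorphism (i.e., T(xy) = T(x)T(y) and T(x*) = T(x)* for all x, y ∈ A) if and only if T is a *-homomorphism at the unit of A. -/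
open Filter Topology

/-- A subring containing all defect idempotents contains the two-sided ideal
generated by each nontrivial one. -/
theorem mul_one_sub_mul_mem {A : Type*} [Ring A] {M : NonUnitalSubring A}
    (hM : ∀ x y : A, y * x = 1 → 1 - x * y ∈ M) {v w : A} (hwv : w * v = 1) (b c : A) :
    b * (1 - v * w) * c ∈ M := by
  obtain ⟨e, he⟩ : ∃ e, e = 1 - v * w := ⟨_, rfl⟩
  rw [← he]
  have hev : e * v = 0 := by rw [he, sub_mul, mul_assoc, hwv]; simp
  have hwe : w * e = 0 := by rw [he, mul_sub, ← mul_assoc, hwv]; simp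
  have hee : e * e = e := by
    nth_rw 2 [he]
    rw [mul_sub, ← mul_assoc, hev]; simp
  have heM : e ∈ M := he ▸ hM v w hwv
  have hl (a : A) : v * w * a * e ∈ M := by
    have := hM v (w - w * a * e) (by rw [sub_mul, mul_assoc, hev, hwv]; simp)
    have h2 : v * w * a * e = (1 - v * (w - w * a * e)) - e := by rw [he]; noncomm_ring
    exact h2 ▸ sub_mem this heM
  have hr (a : A) : e * a * (v * w) ∈ M := by
    have := hM (v - e * a * v) w (by
      rw [mul_sub, hwv, mul_assoc, ← mul_assoc w, hwe]; simp)
    have h2 : e * a * (v * w) = (1 - (v - e * a * v) * w) - e := by rw [he]; noncomm_ring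
    exact h2 ▸ sub_mem this heM
  have hc (a : A) : e * a * e ∈ M := by
    have h2 : e * a * e = (e * (a * w) * (v * w)) * (v * w * v * e) := by
      have h3 : (e * (a * w) * (v * w)) * (v * w * v * e) =
          e * a * (w * v) * (w * v) * (w * v) * e := by noncomm_ring
      rw [h3, hwv]; simp
    exact h2 ▸ mul_mem (hr _) (hl _)
  have hbe : b * e ∈ M := by
    have h2 : b * e = e * b * e + v * w * b * e := by rw [he]; noncomm_ring
    exact h2 ▸ add_mem (hc b) (hl b)
  have hec : e * c ∈ M := by
    have h2 : e * c = e * c * e + e * c * (v * w) := by rw [he]; noncomm_ring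
    exact h2 ▸ add_mem (hc c) (hr c)
  have h2 : b * e * c = (b * e) * (e * c) := by rw [mul_assoc, mul_assoc, ← mul_assoc e, hee]
  exact h2 ▸ mul_mem hbe hec

section Jordan

variable {A B : Type*} [Ring A] [Algebra ℂ A] [NonUnitalRing B] [Module ℂ B]

theorem map_mul_add_map_mul_of_map_mul_self {T : A →ₗ[ℂ] B}
    (h : ∀ x, T (x * x) = T x * T x) (x y : A) :
    T (x * y) + T (y * x) = T x * T y + T y * T x := by
  have hxy := h (x + y)
  simp only [mul_add, add_mul, map_add, h x, h y] at hxy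
  have hc : (T x * T x + T y * T y) + (T (x * y) + T (y * x)) =
      (T x * T x + T y * T y) + (T x * T y + T y * T x) := by
    convert hxy using 1 <;> abel
  exact add_left_cancel hc

/-- A unital Jordan homomorphism respecting one-sided inverses is multiplicative against
the defect idempotents `1 - x * y`, where `y * x = 1`. -/
theorem map_mul_one_sub_of_mul_eq_one {T : A →ₗ[ℂ] B}
    (hJ : ∀ x y, T (x * y) + T (y * x) = T x * T y + T y * T x)
    (hinv : ∀ x y, y * x = 1 → T y * T x = T 1)
    (hleft : ∀ x, T 1 * T x = T x) (hright : ∀ x, T x * T 1 = T x)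
    {x y : A} (hyx : y * x = 1) (a : A) :
    T (a * (1 - x * y)) = T a * T (1 - x * y) := by
  obtain ⟨f, hf⟩ : ∃ f, f = 1 - x * y := ⟨_, rfl⟩
  rw [← hf]
  have hfx : f * x = 0 := by rw [hf, sub_mul, mul_assoc, hyx]; simp
  have hyf : y * f = 0 := by rw [hf, mul_sub, ← mul_assoc, hyx]; simp
  have hff : f * f = f := by
    nth_rw 2 [hf]
    rw [mul_sub, ← mul_assoc, hfx]; simp
  have hTxy : T (x * y) = T x * T y := by
    have := hJ x y
    rw [hyx, hinv x y hyx] at this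
    exact add_right_cancel this
  have hTf : T f = T 1 - T x * T y := by rw [hf, map_sub, hTxy]
  have hu (b : A) : T (b * f) * T f = T (b * f) := by
    have h0 : T (b * f) * T x = 0 := by
      have := hinv x (y + b * f) (by rw [add_mul, mul_assoc, hfx, hyx]; simp)
      rw [map_add, add_mul, hinv x y hyx] at this
      simpa using this
    rw [hTf, mul_sub, hright, ← mul_assoc, h0]; simp
  have hw (b : A) : T f * T (f * b) = T (f * b) := by
    have h0 : T y * T (f * b) = 0 := by
      have := hinv (x + f * b) y (by rw [mul_add, ← mul_assoc, hyf, hyx]; simp)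
      rw [map_add, mul_add, hinv x y hyx] at this
      simpa using this
    rw [hTf, sub_mul, hleft, mul_assoc, h0]; simp
  have hEE : T f * T f = T f := by simpa using hu 1
  have hm₁ : T (f * a * f) = T f * T (a * f) := by
    have := hJ (a * f) f
    rw [mul_assoc, hff, hu, ← mul_assoc] at this
    exact add_left_cancel this
  have hm₂ : T (f * a * f) = T (f * a) * T f := by
    have := hJ (f * a) f
    rw [← mul_assoc f f a, hff, hw] at this
    exact add_right_cancel this
  have hE : T (a * f) + T (f * a * f) = T a * T f + T f * T a * T f := by
    have := congrArg (· * T f) (hJ a f)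
    simpa only [add_mul, hu, ← hm₂, mul_assoc, hEE] using this
  have hm : T (f * a * f) = T f * T a * T f := by
    have := congrArg (T f * ·) hE
    simp only [mul_add, ← mul_assoc, hEE, ← hm₁] at this
    have h2 : T f * T (f * a * f) = T (f * a * f) := by rw [hm₁, ← mul_assoc, hEE]
    rw [h2, ← two_smul ℂ, ← two_smul ℂ] at this
    exact smul_right_injective B (two_ne_zero (α := ℂ)) this
  rw [hm] at hE
  exact add_right_cancel hE

/-- The elements against which `T` is right multiplicative. -/
def rightMultiplicativeDomain (T : A →ₗ[ℂ] B) : NonUnitalSubring A where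
  carrier := {m | ∀ a, T (a * m) = T a * T m}
  zero_mem' := by simp
  add_mem' {m n} hm hn a := by rw [mul_add, map_add, map_add, mul_add, hm, hn]
  neg_mem' {m} hm a := by rw [mul_neg, map_neg, map_neg, mul_neg, hm]
  mul_mem' {m n} hm hn a := by rw [← mul_assoc, hn, hm, hn, mul_assoc]

theorem mem_rightMultiplicativeDomain {T : A →ₗ[ℂ] B} {m : A} :
    m ∈ rightMultiplicativeDomain T ↔ ∀ a, T (a * m) = T a * T m := Iff.rfl

end Jordan

/-- Comparing the resolvent `(1 - t x)⁻¹` with `1 - t x` as `t → 0`. -/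
theorem eq_and_map_mul_self_of_mul_eq_one {A B : Type*}
    [NormedRing A] [CompleteSpace A] [NormedAlgebra ℂ A]
    [NonUnitalNormedRing B] [NormedSpace ℂ B] [IsScalarTower ℂ B B] [SMulCommClass ℂ B B]
    {T S : A →ₗ[ℂ] B} (hT : Continuous T) (hS : Continuous S)
    (hinv : ∀ a b, a * b = 1 → T a * S b = T 1) (h1 : S 1 = T 1)
    (hright : ∀ x, T x * T 1 = T x) (hleft : ∀ x, T 1 * S x = S x) :
    S = T ∧ ∀ x, T (x * x) = T x * T x := by
  have key (x : A) : ∃ r : ℂ → A, Tendsto r (𝓝[≠] 0) (𝓝 1) ∧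
      ∀ᶠ t in 𝓝[≠] 0, t ≠ 0 ∧ r t = 1 + t • (x * r t) ∧ (1 - t • x) * r t = 1 := by
    have hc : Tendsto (fun t : ℂ ↦ 1 - t • x) (𝓝[≠] 0) (𝓝 1) := by
      have : Continuous fun t : ℂ ↦ 1 - t • x := by fun_prop
      simpa using (this.tendsto 0).mono_left nhdsWithin_le_nhds
    refine ⟨fun t ↦ Ring.inverse (1 - t • x), ?_, ?_⟩
    · have h := NormedRing.inverse_continuousAt (1 : Aˣ)
      rw [ContinuousAt, Units.val_one, Ring.inverse_one] at h
      exact h.comp hc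
    · filter_upwards [hc.eventually (Units.nhds (1 : Aˣ)), self_mem_nhdsWithin] with t ht ht0
      have h := Ring.mul_inverse_cancel _ ht
      refine ⟨ht0, ?_, h⟩
      rw [sub_mul, one_mul, smul_mul_assoc, sub_eq_iff_eq_add] at h
      exact h
  have cont {F : A →ₗ[ℂ] B} (hF : Continuous F) (y : A) {r : ℂ → A}
      (hr : Tendsto r (𝓝[≠] 0) (𝓝 1)) :
      Tendsto (fun t ↦ F (y * r t)) (𝓝[≠] 0) (𝓝 (F y)) := by
    have : Continuous fun z ↦ F (y * z) := by fun_prop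
    simpa [Function.comp_def] using (this.tendsto 1).comp hr
  have hid {x r : A} {t : ℂ} (ht : t ≠ 0) (hr : r = 1 + t • (x * r))
      (hxr : (1 - t • x) * r = 1) : S (x * r) = T x + t • (T x * S (x * r)) := by
    have h := hinv _ _ hxr
    have hSr : S r = T 1 + t • S (x * r) := by
      conv_lhs => rw [hr]
      rw [map_add, map_smul, h1]
    rw [hSr, map_sub, map_smul, sub_mul, mul_add, mul_add, ← h1, h1, mul_smul_comm, hleft,
      smul_mul_assoc, smul_mul_assoc, hright, hright, mul_smul_comm] at h
    have h2 : t • S (x * r) = t • (T x + t • (T x * S (x * r))) := by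
      rw [smul_add]
      have h3 := sub_eq_iff_eq_add.1 h
      exact add_left_cancel h3
    exact smul_right_injective B ht h2
  have hST : S = T := by
    ext x
    obtain ⟨r, hr, hev⟩ := key x
    have hl := cont hS x hr
    have ht : Tendsto (fun t : ℂ ↦ t) (𝓝[≠] 0) (𝓝 0) := nhdsWithin_le_nhds
    have hrhs := (tendsto_const_nhds (x := T x)).add (ht.smul (hl.const_mul (T x)))
    rw [zero_smul, add_zero] at hrhs
    refine tendsto_nhds_unique hl (hrhs.congr' ?_)
    filter_upwards [hev] with t ⟨ht0, h, h'⟩ using (hid ht0 h h').symm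
  refine ⟨hST, fun x ↦ ?_⟩
  obtain ⟨r, hr, hev⟩ := key x
  refine tendsto_nhds_unique (cont hT (x * x) hr)
    (((cont hT x hr).const_mul (T x)).congr' ?_)
  filter_upwards [hev] with t ⟨ht0, h, h'⟩
  have h2 := hid ht0 h h'
  rw [hST] at h2
  have h3 : x * r t = x + t • (x * x * r t) := by
    conv_lhs => rw [h]
    rw [mul_add, mul_one, mul_smul_comm, ← mul_assoc]
  have h4 : T (x * r t) = T x + t • T (x * x * r t) := by
    conv_lhs => rw [h3]
    rw [map_add, map_smul]
  exact smul_right_injective B ht0 (add_left_cancel (h2.symm.trans h4))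

/-- In a C*-algebra, `x * star x = p` for a projection `p` forces `p * x = x`. -/
theorem IsStarProjection.mul_eq_of_mul_star_eq {B : Type*} [NonUnitalNormedRing B] [StarRing B]
    [CStarRing B] {p x : B} (hp : IsStarProjection p) (h : x * star x = p) : p * x = x := by
  rw [← sub_eq_zero, ← CStarRing.mul_star_self_eq_zero_iff]
  rw [star_sub, star_mul, hp.isSelfAdjoint.star_eq, sub_mul, mul_sub, mul_sub, h,
    ← mul_assoc, mul_assoc p x, h, ← mul_assoc x, h, hp.isIdempotentElem.eq,
    hp.isIdempotentElem.eq]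
  simp

theorem LinearMap.continuous_of_norm_unitary_le {A B : Type*} [CStarAlgebra A]
    [NormedAddCommGroup B] [NormedSpace ℂ B] (T : A →ₗ[ℂ] B) {C : ℝ}
    (hT : ∀ u ∈ unitary A, ‖T u‖ ≤ C) : Continuous T := by
  refine AddMonoidHomClass.continuous_of_bound T (2 * C) fun x ↦ ?_
  obtain ⟨u, c, hx, hc⟩ := CStarAlgebra.exists_sum_four_unitary x
  calc ‖T x‖ = ‖∑ i, c i • T (u i)‖ := by
        conv_lhs => rw [hx]
        simp
    _ ≤ ∑ i, ‖c i • T (u i)‖ := norm_sum_le _ _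
    _ ≤ ∑ _i : Fin 4, ‖x‖ / 2 * C := by
        gcongr with i
        rw [norm_smul]
        exact mul_le_mul (hc i) (hT _ (u i).2) (norm_nonneg _) (by positivity)
    _ = 2 * C * ‖x‖ := by
        simp
        ring

theorem IsStarHomAt.jordan_and_continuous {A B : Type*} [CStarAlgebra A]
    [NonUnitalNormedRing B] [StarRing B] [CStarRing B]
    [NormedSpace ℂ B] [IsScalarTower ℂ B B] [SMulCommClass ℂ B B] [StarModule ℂ B]
    {T : A →ₗ[ℂ] B} (h : IsStarHomAt T 1) :
    (∀ x, T 1 * T x = T x) ∧ (∀ x, T x * T 1 = T x) ∧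
      (∀ x, T (star x) = star (T x)) ∧ (∀ x, T (x * x) = T x * T x) ∧ Continuous T := by
  have hp1 : T 1 * star (T 1) = T 1 := (h.1 1 1 (by simp)).2
  have hsa : star (T 1) = T 1 := by
    conv_lhs => rw [← hp1]
    rw [star_mul, star_star, hp1]
  have hp : IsStarProjection (T 1) := ⟨by rw [IsIdempotentElem]; nth_rw 2 [← hsa]; exact hp1, hsa⟩
  have hU {u : A} (hu : u ∈ unitary A) : T u * star (T u) = T 1 :=
    (h.1 u u (Unitary.mul_star_self_of_mem hu)).2
  have hU' {u : A} (hu : u ∈ unitary A) : star (T u) * T u = T 1 :=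
    (h.2 u u (Unitary.star_mul_self_of_mem hu)).2
  have hleft (x : A) : T 1 * T x = T x := by
    have hx : x ∈ Submodule.span ℂ (unitary A : Set A) := by
      rw [CStarAlgebra.span_unitary]; trivial
    induction hx using Submodule.span_induction with
    | mem u hu => exact hp.mul_eq_of_mul_star_eq (hU hu)
    | zero => simp
    | add y z _ _ hy hz => rw [map_add, mul_add, hy, hz]
    | smul c y _ hy => rw [map_smul, mul_smul_comm, hy]
  have hright (x : A) : T x * T 1 = T x := by
    have hx : x ∈ Submodule.span ℂ (unitary A : Set A) := by
      rw [CStarAlgebra.span_unitary]; trivial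
    induction hx using Submodule.span_induction with
    | mem u hu =>
      have := hp.mul_eq_of_mul_star_eq (x := star (T u)) (by rw [star_star, hU' hu])
      simpa [hsa] using congrArg star this
    | zero => simp
    | add y z _ _ hy hz => rw [map_add, add_mul, hy, hz]
    | smul c y _ hy => rw [map_smul, smul_mul_assoc, hy]
  have hT : Continuous T := T.continuous_of_norm_unitary_le (C := ‖T 1‖ + 1) fun u hu ↦ by
    have h1 := CStarRing.norm_star_mul_self (x := T u)
    rw [hU' hu] at h1
    nlinarith [norm_nonneg (T u), norm_nonneg (T 1), sq_nonneg (‖T u‖ - 1)]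
  let S : A →ₗ[ℂ] B :=
    { toFun := fun x ↦ star (T (star x))
      map_add' := by simp
      map_smul' := by simp }
  have hSdef (x : A) : S x = star (T (star x)) := rfl
  have hS : Continuous S := continuous_star.comp (hT.comp continuous_star)
  obtain ⟨hST, hsq⟩ := eq_and_map_mul_self_of_mul_eq_one (T := T) (S := S) hT hS
    (fun a b hab ↦ (h.1 a (star b) (by simpa using hab)).2)
    (by rw [hSdef, star_one, hsa]) hright
    (fun x ↦ by rw [hSdef]; simpa [hsa] using congrArg star (hright (star x)))
  refine ⟨hleft, hright, fun x ↦ ?_, hsq, hT⟩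
  rw [← hST, hSdef, star_star, hST]

theorem stmt5 {A B : Type*}
    [NormedRing A] [StarRing A] [CStarRing A] [CompleteSpace A]
    [NormedAlgebra ℂ A] [StarModule ℂ A]
    [NonUnitalNormedRing B] [StarRing B] [CStarRing B] [CompleteSpace B]
    [NormedSpace ℂ B] [IsScalarTower ℂ B B] [SMulCommClass ℂ B B] [StarModule ℂ B]
    (hsimple : ∀ I : TwoSidedIdeal A, IsClosed (I : Set A) → I = ⊥ ∨ I = ⊤)
    (hinfinite : ∃ v : A, star v * v = 1 ∧ v * star v ≠ 1)
    (T : A →ₗ[ℂ] B) :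
    ((∀ x y : A, T (x * y) = T x * T y) ∧ (∀ x : A, T (star x) = star (T x)))
      ↔ IsStarHomAt (⇑T) 1 := by
  constructor
  · rintro ⟨hmul, hstar⟩
    refine ⟨fun a b hab ↦ ?_, fun c d hcd ↦ ?_⟩
    · rw [← hstar, ← hmul, hab]; exact ⟨rfl, rfl⟩
    · rw [← hstar, ← hmul, hcd]; exact ⟨rfl, rfl⟩
  intro h
  let _ : CStarAlgebra A := {}
  obtain ⟨hleft, hright, hstar, hsq, hT⟩ := h.jordan_and_continuous
  obtain ⟨v, hv, hv'⟩ := hinfinite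
  have hM (x y : A) (hyx : y * x = 1) : 1 - x * y ∈ rightMultiplicativeDomain T :=
    map_mul_one_sub_of_mul_eq_one (map_mul_add_map_mul_of_map_mul_self hsq)
      (fun x y hyx ↦ by
        have := (h.1 y (star x) (by simpa using hyx)).2
        rwa [hstar, star_star] at this) hleft hright hyx
  let I : TwoSidedIdeal A := TwoSidedIdeal.mk'
    {z | ∀ b c, b * z * c ∈ rightMultiplicativeDomain T}
    (fun b c ↦ by simp)
    (fun hx hy b c ↦ by rw [mul_add, add_mul]; exact add_mem (hx b c) (hy b c))
    (fun hx b c ↦ by rw [mul_neg, neg_mul]; exact neg_mem (hx b c))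
    (fun {x y} hy b c ↦ by rw [← mul_assoc b]; exact hy (b * x) c)
    (fun {x y} hx b c ↦ by rw [← mul_assoc b, mul_assoc]; exact hx b (y * c))
  have hmemI (z : A) : z ∈ I ↔ ∀ b c, b * z * c ∈ rightMultiplicativeDomain T :=
    TwoSidedIdeal.mem_mk' ..
  have hclosed : IsClosed (I : Set A) := by
    have hI : (I : Set A) = {z | ∀ b c a, T (a * (b * z * c)) = T a * T (b * z * c)} :=
      Set.ext hmemI
    rw [hI]
    simp only [Set.ofPred_forall]
    exact isClosed_iInter fun b ↦ isClosed_iInter fun c ↦ isClosed_iInter fun a ↦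
      isClosed_eq (by fun_prop) (by fun_prop)
  have heI : 1 - v * star v ∈ I := (hmemI _).2 (mul_one_sub_mul_mem hM hv)
  have htop : I = ⊤ := (hsimple I hclosed).resolve_left fun hbot ↦ hv' <| by
    rw [hbot, TwoSidedIdeal.mem_bot] at heI
    exact (sub_eq_zero.1 heI).symm
  refine ⟨fun x y ↦ ?_, hstar⟩
  have h1 : (1 : A) ∈ I := htop ▸ TwoSidedIdeal.mem_top _
  simpa using (hmemI 1).1 h1 1 y x
end

section
/- Let A and B be C*-algebras with A unital, and let T : A → B be a linear map satisfying: (a') for all a, b ∈ A, a* b = 1 implies T(a)* T(b) = T(1); and (b') for all c, d ∈ A, c d* = 0 implies T(c) T(d)* = 0. Then T is a *-homomorphism, i.e., T(xy) = T(x) T(y) and T(x*) = T(x)* for all x, y ∈ A. -/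
section

variable {A B : Type*} [CStarAlgebra A] [NonUnitalCStarAlgebra B]

/-- A self-adjoint element splits as a difference of orthogonal self-adjoint elements, each of
which is within half the norm of a scalar. -/
lemma IsSelfAdjoint.exists_orthogonal_sub {h : A} (hh : IsSelfAdjoint h) :
    ∃ a b : A, IsSelfAdjoint a ∧ IsSelfAdjoint b ∧ a * b = 0 ∧ h = a - b ∧
      ‖a - algebraMap ℝ A (‖h‖ / 2)‖ ≤ ‖h‖ / 2 ∧ ‖b - algebraMap ℝ A (‖h‖ / 2)‖ ≤ ‖h‖ / 2 := by
  rcases subsingleton_or_nontrivial A with _ | _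
  · exact ⟨0, 0, by simp, by simp, by simp, Subsingleton.elim _ _,
      by rw [Subsingleton.elim (0 - _) (0 : A)]; simp; positivity,
      by rw [Subsingleton.elim (0 - _) (0 : A)]; simp; positivity⟩
  have key : ∀ f : ℝ → ℝ, Continuous f → (∀ t, |t| ≤ ‖h‖ → 0 ≤ f t ∧ f t ≤ ‖h‖) →
      ‖cfc f h - algebraMap ℝ A (‖h‖ / 2)‖ ≤ ‖h‖ / 2 := by
    intro f hf hfb
    rw [← cfc_const (‖h‖ / 2) h, ← cfc_sub f _ h (hf.continuousOn)]
    refine norm_cfc_le (by positivity) fun t ht ↦ ?_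
    have := hfb t (spectrum.norm_le_norm_of_mem ht)
    rw [Real.norm_eq_abs, abs_le]
    constructor <;> linarith
  refine ⟨cfc (fun t : ℝ ↦ max t 0) h, cfc (fun t : ℝ ↦ max (-t) 0) h, cfc_predicate _ _,
    cfc_predicate _ _, ?_, ?_, key _ (by fun_prop) ?_, key _ (by fun_prop) ?_⟩
  · rw [← cfc_mul _ _ h]
    convert cfc_const_zero ℝ h using 2
    ext t
    rcases le_total t 0 with ht | ht <;> simp [ht]
  · rw [← cfc_sub _ _ h]
    conv_lhs => rw [← cfc_id' ℝ h]
    congr 1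
    ext t
    rcases le_total t 0 with ht | ht <;> simp [ht]
  · exact fun t ht ↦ ⟨le_max_right _ _, max_le (le_of_abs_le ht) (norm_nonneg _)⟩
  · exact fun t ht ↦ ⟨le_max_right _ _, max_le ((neg_le_abs t).trans ht) (norm_nonneg _)⟩

/-- A bounded linear map that vanishes at `1` and sends orthogonal self-adjoint elements to
elements with orthogonal right supports is zero. -/
lemma LinearMap.eq_zero_of_mul_star_eq_zero (L : A →ₗ[ℂ] B) {C : ℝ}
    (hC : ∀ a, ‖L a‖ ≤ C * ‖a‖) (h1 : L 1 = 0)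
    (hL : ∀ a b, IsSelfAdjoint a → IsSelfAdjoint b → a * b = 0 → L a * star (L b) = 0) :
    L = 0 := by
  have hshift : ∀ (a : A) (r : ℝ), L (a - algebraMap ℝ A r) = L a := by
    intro a r
    rw [map_sub, Algebra.algebraMap_eq_smul_one, ← Complex.coe_smul, map_smul, h1, smul_zero,
      sub_zero]
  have hbound : ∀ n : ℕ, ∀ h : A, IsSelfAdjoint h →
      ‖L h‖ ^ 2 ≤ C ^ 2 * (1 / 2) ^ n * ‖h‖ ^ 2 := by
    intro n
    induction n with
    | zero =>
      intro h _
      rw [pow_zero, mul_one, ← mul_pow]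
      exact pow_le_pow_left₀ (norm_nonneg _) (hC h) 2
    | succ n ih =>
      intro h hh
      obtain ⟨a, b, ha, hb, hab, rfl, hna, hnb⟩ := hh.exists_orthogonal_sub
      set r := ‖a - b‖ / 2 with hr
      have hsa : ∀ r : ℝ, IsSelfAdjoint (algebraMap ℝ A r) := fun r ↦
        (IsSelfAdjoint.all r).algebraMap A
      have step : ∀ c : A, IsSelfAdjoint c → ‖c - algebraMap ℝ A r‖ ≤ r →
          ‖L c‖ ^ 2 ≤ C ^ 2 * (1 / 2) ^ n * r ^ 2 := by
        intro c hc hcr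
        have := ih _ (hc.sub (hsa r))
        rw [hshift] at this
        refine this.trans ?_
        gcongr
      have hba : b * a = 0 := by
        simpa [ha.star_eq, hb.star_eq] using congrArg star hab
      have hexp : L (a - b) * star (L (a - b)) = L a * star (L a) + L b * star (L b) := by
        rw [map_sub, star_sub, sub_mul, mul_sub, mul_sub, hL a b ha hb hab, hL b a hb ha hba]
        abel
      have hnorm : ‖L (a - b)‖ ^ 2 ≤ ‖L a‖ ^ 2 + ‖L b‖ ^ 2 := by
        simp only [pow_two, ← CStarRing.norm_self_mul_star]
        rw [hexp]
        exact norm_add_le _ _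
      calc ‖L (a - b)‖ ^ 2 ≤ ‖L a‖ ^ 2 + ‖L b‖ ^ 2 := hnorm
        _ ≤ C ^ 2 * (1 / 2) ^ n * r ^ 2 + C ^ 2 * (1 / 2) ^ n * r ^ 2 :=
          add_le_add (step a ha hna) (step b hb hnb)
        _ = C ^ 2 * (1 / 2) ^ (n + 1) * ‖a - b‖ ^ 2 := by rw [hr]; ring
  have hzero : ∀ h : A, IsSelfAdjoint h → L h = 0 := by
    intro h hh
    have hlim : Filter.Tendsto (fun n : ℕ ↦ C ^ 2 * (1 / 2 : ℝ) ^ n * ‖h‖ ^ 2) Filter.atTop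
        (nhds (C ^ 2 * 0 * ‖h‖ ^ 2)) :=
      ((tendsto_pow_atTop_nhds_zero_of_lt_one (by norm_num) (by norm_num)).const_mul _).mul_const _
    have := ge_of_tendsto' hlim fun n ↦ hbound n h hh
    rw [mul_zero, zero_mul] at this
    exact norm_eq_zero.1 (pow_eq_zero_iff two_ne_zero |>.1 (this.antisymm (sq_nonneg _)))
  ext x
  rw [← realPart_add_I_smul_imaginaryPart x, map_add, map_smul, hzero _ (realPart x).2,
    hzero _ (imaginaryPart x).2]
  simp

/-- A linear map that is bounded on the unitary group is bounded. -/
lemma LinearMap.norm_apply_le_of_unitary (T : A →ₗ[ℂ] B) {M : ℝ}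
    (hT : ∀ u ∈ unitary A, ‖T u‖ ≤ M) (x : A) : ‖T x‖ ≤ 2 * M * ‖x‖ := by
  obtain ⟨u, c, hx, hc⟩ := CStarAlgebra.exists_sum_four_unitary x
  calc ‖T x‖ = ‖∑ i, c i • T (u i)‖ := by conv_lhs => rw [hx, map_sum]; simp only [map_smul]
    _ ≤ ∑ i, ‖c i • T (u i)‖ := norm_sum_le _ _
    _ ≤ ∑ _i : Fin 4, ‖x‖ / 2 * M := by
      refine Finset.sum_le_sum fun i _ ↦ ?_
      rw [norm_smul]
      exact mul_le_mul (hc i) (hT _ (u i).2) (norm_nonneg _) (by positivity)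
    _ = 2 * M * ‖x‖ := by simp; ring

/-- If `T` preserves the relation `star a * b = 1`, then `T 1` is a projection. -/
lemma isStarProjection_map_one {T : A →ₗ[ℂ] B}
    (ha : ∀ a b : A, star a * b = 1 → star (T a) * T b = T 1) : IsStarProjection (T 1) := by
  have h := ha 1 1 (by simp)
  have hsa : IsSelfAdjoint (T 1) := h ▸ IsSelfAdjoint.star_mul_self (T 1)
  exact ⟨by rw [IsIdempotentElem]; simpa only [hsa.star_eq] using h, hsa⟩

lemma map_mul_map_one {T : A →ₗ[ℂ] B}
    (ha : ∀ a b : A, star a * b = 1 → star (T a) * T b = T 1) (x : A) : T x * T 1 = T x := by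
  obtain ⟨hp, hs⟩ := isStarProjection_map_one ha
  have hx : x ∈ Submodule.span ℂ (unitary A : Set A) := by
    rw [CStarAlgebra.span_unitary]; trivial
  induction hx using Submodule.span_induction with
  | mem u hu =>
    have huu := ha u u (Unitary.star_mul_self_of_mem hu)
    rw [← sub_eq_zero, ← CStarRing.star_mul_self_eq_zero_iff]
    have : star (T u * T 1 - T u) * (T u * T 1 - T u) =
        T 1 * (star (T u) * T u) * T 1 - T 1 * (star (T u) * T u)
          - (star (T u) * T u) * T 1 + star (T u) * T u := by
      rw [star_sub, star_mul, hs.star_eq]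
      noncomm_ring
    rw [this, huu, hp.eq, hp.eq]
    abel
  | zero => simp
  | add x y _ _ hx hy => rw [map_add, add_mul, hx, hy]
  | smul c x _ hx => rw [map_smul, smul_mul_assoc, hx]

lemma norm_map_le_of_map_inverse {T : A →ₗ[ℂ] B}
    (ha : ∀ a b : A, star a * b = 1 → star (T a) * T b = T 1) (x : A) : ‖T x‖ ≤ 2 * ‖x‖ := by
  obtain ⟨hp, hs⟩ := isStarProjection_map_one ha
  have hone : ‖T 1‖ ≤ 1 := by
    have := CStarRing.norm_star_mul_self (x := T 1)
    rw [hs.star_eq, hp.eq] at this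
    nlinarith [norm_nonneg (T 1)]
  have := T.norm_apply_le_of_unitary (M := 1) (fun u hu ↦ ?_) x
  · linarith
  · have := CStarRing.norm_star_mul_self (x := T u)
    rw [ha u u (Unitary.star_mul_self_of_mem hu)] at this
    nlinarith [norm_nonneg (T u)]

/-- The first-order part of the relation `star (T a) * T b = T 1` for `star a * b = 1` near the
identity. -/
lemma map_one_mul_map_star {T : A →ₗ[ℂ] B}
    (ha : ∀ a b : A, star a * b = 1 → star (T a) * T b = T 1) (x : A) :
    T 1 * T (star x) = star (T x) * T 1 := by
  obtain ⟨hp, hs⟩ := isStarProjection_map_one ha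
  have hC := norm_map_le_of_map_inverse ha
  set G : A → B := fun x ↦ T 1 * T (star x) - star (T x) * T 1 with hG
  have hsmul : ∀ (t : ℝ) (y : A), G ((t : ℂ) • y) = (t : ℂ) • G y := by
    intro t y
    simp only [hG, star_smul, map_smul, mul_smul_comm, smul_mul_assoc, smul_sub, RCLike.star_def,
      Complex.conj_ofReal]
  obtain ⟨K, hK⟩ : ∃ K : ℝ, ∀ y : A, ‖y‖ ≤ 1 / 2 → ‖G y‖ ≤ K * ‖y‖ ^ 2 := by
    refine ⟨4 + 12 * ‖(1 : A)‖ ^ 2, fun y hy ↦ ?_⟩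
    have hy' : ‖star y‖ < 1 := by rw [norm_star]; linarith
    obtain ⟨b, hb⟩ : ∃ b : A, (1 - star y) * b = 1 :=
      ⟨_, (Units.oneSub (star y) hy').mul_inv⟩
    have hb1 : b = 1 + star y * b := by
      rw [sub_mul, one_mul, sub_eq_iff_eq_add] at hb
      exact hb
    have hb2 : b = 1 + star y + star y * star y * b := by
      conv_lhs => rw [hb1, hb1]
      noncomm_ring
    have hbn : ‖b‖ ≤ 2 * ‖(1 : A)‖ := by
      have h1 : ‖b‖ ≤ ‖(1 : A)‖ + ‖y‖ * ‖b‖ := by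
        conv_lhs => rw [hb1]
        exact (norm_add_le _ _).trans (by gcongr; simpa using norm_mul_le (star y) b)
      nlinarith [norm_nonneg b]
    have hrel := ha (1 - y) b (by rw [star_sub, star_one, hb])
    set c := star y * star y * b with hc
    have hcn : ‖c‖ ≤ ‖y‖ ^ 2 * (2 * ‖(1 : A)‖) := by
      calc ‖c‖ ≤ ‖star y‖ * ‖star y‖ * ‖b‖ := norm_mul₃_le
        _ ≤ ‖y‖ ^ 2 * (2 * ‖(1 : A)‖) := by rw [norm_star, ← pow_two]; gcongr
    have hGy : G y = star (T y) * T (star y) - star (T (1 - y)) * T c := by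
      rw [hb2, map_add, map_add, mul_add] at hrel
      rw [eq_sub_iff_add_eq, hG, ← sub_eq_zero, ← sub_eq_zero.2 hrel, map_sub, star_sub,
        hs.star_eq]
      simp only [mul_add, sub_mul, hp.eq]
      abel
    have h1y : ‖(1 : A) - y‖ ≤ ‖(1 : A)‖ + ‖y‖ := norm_sub_le _ _
    have hone : ‖y‖ ≤ ‖(1 : A)‖ / 2 := by
      rcases subsingleton_or_nontrivial A with _ | _
      · simp [Subsingleton.elim y 0, Subsingleton.elim (1 : A) 0]
      · rw [CStarRing.norm_one]; exact hy
    calc ‖G y‖ ≤ ‖star (T y)‖ * ‖T (star y)‖ + ‖star (T (1 - y))‖ * ‖T c‖ := by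
          rw [hGy]
          exact (norm_sub_le _ _).trans (add_le_add (norm_mul_le _ _) (norm_mul_le _ _))
      _ ≤ (2 * ‖y‖) * (2 * ‖y‖) +
          (2 * (‖(1 : A)‖ + ‖(1 : A)‖ / 2)) * (2 * (‖y‖ ^ 2 * (2 * ‖(1 : A)‖))) := by
        rw [norm_star, norm_star]
        gcongr
        · exact hC y
        · simpa using hC (star y)
        · exact (hC _).trans (by linarith)
        · exact (hC c).trans (by linarith)
      _ = (4 + 12 * ‖(1 : A)‖ ^ 2) * ‖y‖ ^ 2 := by ring
  have hGx : ∀ᶠ t : ℝ in nhdsWithin 0 (Set.Ioi 0), ‖G x‖ ≤ t * (K * ‖x‖ ^ 2) := by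
    have hsmall : ∀ᶠ t : ℝ in nhdsWithin 0 (Set.Ioi 0), t * ‖x‖ < 1 / 2 := by
      have : Filter.Tendsto (fun t : ℝ ↦ t * ‖x‖) (nhds 0) (nhds (0 * ‖x‖)) :=
        Filter.tendsto_id.mul_const _
      rw [zero_mul] at this
      exact (this.mono_left nhdsWithin_le_nhds).eventually_lt_const (by norm_num)
    filter_upwards [hsmall, self_mem_nhdsWithin] with t ht ht0
    have ht0 : 0 < t := ht0
    have hn : ‖(t : ℂ) • x‖ = t * ‖x‖ := by
      rw [norm_smul, Complex.norm_real, Real.norm_of_nonneg ht0.le]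
    have := hK ((t : ℂ) • x) (by rw [hn]; exact ht.le)
    rw [hsmul, hn, norm_smul, Complex.norm_real, Real.norm_of_nonneg ht0.le] at this
    refine le_of_mul_le_mul_left ?_ ht0
    linarith
  have hlim : Filter.Tendsto (fun t : ℝ ↦ t * (K * ‖x‖ ^ 2)) (nhdsWithin 0 (Set.Ioi 0))
      (nhds (0 * (K * ‖x‖ ^ 2))) :=
    (Filter.tendsto_id.mul_const _).mono_left nhdsWithin_le_nhds
  have := ge_of_tendsto hlim hGx
  rw [zero_mul] at this
  exact sub_eq_zero.1 (norm_le_zero_iff.1 this)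

/-- If `T` preserves the relations `star a * b = 1` and `c * star d = 0`, then `T 1` is a left
unit for the range of `T`. -/
lemma map_one_mul_map {T : A →ₗ[ℂ] B}
    (ha : ∀ a b : A, star a * b = 1 → star (T a) * T b = T 1)
    (hb : ∀ c d : A, c * star d = 0 → T c * star (T d) = 0) (x : A) : T 1 * T x = T x := by
  obtain ⟨hp, hs⟩ := isStarProjection_map_one ha
  have hC := norm_map_le_of_map_inverse ha
  let N : A →ₗ[ℂ] B := T - LinearMap.mulLeft ℂ (T 1) ∘ₗ T
  have hN : ∀ x, N x = T x - T 1 * T x := fun _ ↦ rfl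
  have hN0 : N = 0 := by
    refine N.eq_zero_of_mul_star_eq_zero (C := 2 + ‖T 1‖ * 2) (fun a ↦ ?_) ?_ ?_
    · rw [hN, add_mul, mul_assoc]
      refine (norm_sub_le _ _).trans (add_le_add (hC a) ((norm_mul_le _ _).trans ?_))
      gcongr
      exact hC a
    · rw [hN, hp.eq, sub_self]
    · intro a b _ hb' hab
      have hz := hb a b (by rw [hb'.star_eq, hab])
      have : N a * star (N b) = T a * star (T b) - T 1 * (T a * star (T b))
          - (T a * star (T b)) * T 1 + T 1 * (T a * star (T b)) * T 1 := by
        rw [hN, hN, star_sub, star_mul, hs.star_eq]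
        noncomm_ring
      rw [this, hz]
      simp
  exact (sub_eq_zero.1 ((hN x).symm.trans (by rw [hN0]; rfl))).symm

lemma map_star_of_map_inverse_of_map_orthogonal {T : A →ₗ[ℂ] B}
    (ha : ∀ a b : A, star a * b = 1 → star (T a) * T b = T 1)
    (hb : ∀ c d : A, c * star d = 0 → T c * star (T d) = 0) (x : A) :
    T (star x) = star (T x) := by
  have h := map_one_mul_map_star ha x
  rw [map_one_mul_map ha hb] at h
  rw [h]
  conv_rhs => rw [← map_one_mul_map ha hb x, star_mul, (isStarProjection_map_one ha).2.star_eq]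

lemma map_mul_of_map_inverse_of_map_orthogonal {T : A →ₗ[ℂ] B}
    (ha : ∀ a b : A, star a * b = 1 → star (T a) * T b = T 1)
    (hb : ∀ c d : A, c * star d = 0 → T c * star (T d) = 0) (x y : A) :
    T (x * y) = T x * T y := by
  have hstar := map_star_of_map_inverse_of_map_orthogonal ha hb
  have hC := norm_map_le_of_map_inverse ha
  have hzero : ∀ c d : A, c * d = 0 → T c * T d = 0 := by
    intro c d hcd
    simpa [hstar] using hb c (star d) (by rwa [star_star])
  let D : A →ₗ[ℂ] B := T ∘ₗ LinearMap.mulLeft ℂ x - LinearMap.mulLeft ℂ (T x) ∘ₗ T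
  have hD : ∀ y, D y = T (x * y) - T x * T y := fun _ ↦ rfl
  have hD0 : D = 0 := by
    refine D.eq_zero_of_mul_star_eq_zero (C := 2 * ‖x‖ + ‖T x‖ * 2) (fun a ↦ ?_) ?_ ?_
    · rw [hD, add_mul, mul_assoc, mul_assoc]
      refine (norm_sub_le _ _).trans (add_le_add ((hC _).trans ?_) ((norm_mul_le _ _).trans ?_))
      · gcongr
        exact norm_mul_le _ _
      · gcongr
        exact hC a
    · rw [hD, mul_one, map_mul_map_one ha, sub_self]
    · intro a b _ hb' hab
      have hbstar : star (D b) = T (b * star x) - T b * T (star x) := by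
        rw [hD, star_sub, star_mul, ← hstar, ← hstar, ← hstar, star_mul, hb'.star_eq]
      have h1 : T (x * a) * T (b * star x) = 0 :=
        hzero _ _ (by rw [mul_assoc, ← mul_assoc a, hab]; simp)
      have h2 : T (x * a) * T b = 0 := hzero _ _ (by rw [mul_assoc, hab, mul_zero])
      have h3 : T a * T (b * star x) = 0 := hzero _ _ (by rw [← mul_assoc, hab, zero_mul])
      have h4 : T a * T b = 0 := hzero _ _ hab
      have : D a * star (D b) = T (x * a) * T (b * star x) - T (x * a) * T b * T (star x)
          - T x * (T a * T (b * star x)) + T x * (T a * T b) * T (star x) := by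
        rw [hbstar, hD]
        noncomm_ring
      rw [this, h1, h2, h3, h4]
      simp
  exact sub_eq_zero.1 ((hD y).symm.trans (by rw [hD0]; rfl))

end

theorem stmt7 {A B : Type*}
    [NormedRing A] [StarRing A] [CStarRing A] [CompleteSpace A]
    [NormedAlgebra ℂ A] [StarModule ℂ A]
    [NonUnitalNormedRing B] [StarRing B] [CStarRing B] [CompleteSpace B]
    [NormedSpace ℂ B] [IsScalarTower ℂ B B] [SMulCommClass ℂ B B] [StarModule ℂ B]
    (T : A →ₗ[ℂ] B)
    (ha : ∀ a b : A, star a * b = 1 → star (T a) * T b = T 1)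
    (hb : ∀ c d : A, c * star d = 0 → T c * star (T d) = 0) :
    (∀ x y : A, T (x * y) = T x * T y) ∧ (∀ x : A, T (star x) = star (T x)) := by
  let _ : CStarAlgebra A := { }
  let _ : NonUnitalCStarAlgebra B := { }
  exact ⟨map_mul_of_map_inverse_of_map_orthogonal ha hb,
    map_star_of_map_inverse_of_map_orthogonal ha hb⟩
end

section
/- Let A and B be C*-algebras with A unital, and let T : A → B be a linear map. Then the following are equivalent: (a) T is a *-homomorphism (T(xy) = T(x)T(y) and T(x*) = T(x)* for all x, y ∈ A); (b) T is a *-homomorphism at 0 and a *-homomorphism at 1. -/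
namespace IsStarHomAt

section Basic

variable {A B : Type*} [CStarAlgebra A] [NonUnitalCStarAlgebra B] {T : A →ₗ[ℂ] B}

lemma map_one_mul_star (h : IsStarHomAt T 1) : T 1 * star (T 1) = T 1 :=
  (h.1 1 1 (by simp)).2

lemma star_map_one (h : IsStarHomAt T 1) : star (T 1) = T 1 := by
  conv_lhs => rw [← h.map_one_mul_star]
  rw [star_mul, star_star, h.map_one_mul_star]

lemma map_one_mul_self (h : IsStarHomAt T 1) : T 1 * T 1 = T 1 := by
  simpa [h.star_map_one] using h.map_one_mul_star

lemma map_unitary_mul_star (h : IsStarHomAt T 1) (u : unitary A) :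
    T u * star (T u) = T 1 :=
  (h.1 u u (Unitary.coe_mul_star_self u)).2

lemma star_mul_map_unitary (h : IsStarHomAt T 1) (u : unitary A) :
    star (T u) * T u = T 1 :=
  (h.2 u u (Unitary.coe_star_mul_self u)).2

lemma norm_map_unitary (h : IsStarHomAt T 1) (u : unitary A) : ‖T u‖ = ‖T 1‖ := by
  have h1 : ‖T u‖ * ‖T u‖ = ‖T 1‖ := by
    rw [← CStarRing.norm_self_mul_star, h.map_unitary_mul_star]
  have h2 : ‖T 1‖ * ‖T 1‖ = ‖T 1‖ := by
    rw [← CStarRing.norm_self_mul_star, h.map_one_mul_star]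
  exact (mul_self_inj (norm_nonneg _) (norm_nonneg _)).1 (h1.trans h2.symm)

lemma norm_map_le (h : IsStarHomAt T 1) (x : A) : ‖T x‖ ≤ 2 * ‖T 1‖ * ‖x‖ := by
  obtain ⟨u, c, hx, hc⟩ := CStarAlgebra.exists_sum_four_unitary x
  calc ‖T x‖ = ‖∑ i, c i • T (u i)‖ := by conv_lhs => rw [hx, map_sum]; simp only [map_smul]
    _ ≤ ∑ i, ‖c i • T (u i)‖ := norm_sum_le _ _
    _ ≤ ∑ _i : Fin 4, ‖x‖ / 2 * ‖T 1‖ := by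
        gcongr with i
        rw [norm_smul, h.norm_map_unitary]
        gcongr
        exact hc i
    _ = 2 * ‖T 1‖ * ‖x‖ := by simp; ring

lemma continuous (h : IsStarHomAt T 1) : Continuous T :=
  AddMonoidHomClass.continuous_of_bound T _ h.norm_map_le

lemma map_one_mul (h : IsStarHomAt T 1) (x : A) : T 1 * T x = T x := by
  obtain ⟨u, c, rfl, -⟩ := CStarAlgebra.exists_sum_four_unitary x
  simp only [map_sum, map_smul, Finset.mul_sum, mul_smul_comm]
  refine Finset.sum_congr rfl fun i _ ↦ congrArg _ ?_
  rw [← sub_eq_zero, ← CStarRing.mul_star_self_eq_zero_iff]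
  simp only [star_sub, star_mul, h.star_map_one, sub_mul, mul_sub, mul_assoc,
    h.map_unitary_mul_star, h.map_one_mul_self]
  simp [← mul_assoc, h.map_unitary_mul_star, h.map_one_mul_self]

lemma mul_map_one (h : IsStarHomAt T 1) (x : A) : T x * T 1 = T x := by
  obtain ⟨u, c, rfl, -⟩ := CStarAlgebra.exists_sum_four_unitary x
  simp only [map_sum, map_smul, Finset.sum_mul, smul_mul_assoc]
  refine Finset.sum_congr rfl fun i _ ↦ congrArg _ ?_
  rw [← h.star_mul_map_unitary (u i), ← mul_assoc, h.map_unitary_mul_star, h.map_one_mul]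

open Filter Topology in
lemma _root_.eventually_inverse_one_sub_smul (a : A) :
    (∀ᶠ t : ℂ in 𝓝[≠] 0, (1 - t • a) * Ring.inverse (1 - t • a) = 1) ∧
    Tendsto (fun t : ℂ ↦ Ring.inverse (1 - t • a)) (𝓝[≠] 0) (𝓝 1) := by
  have h0 : Tendsto (fun t : ℂ ↦ 1 - t • a) (𝓝[≠] 0) (𝓝 1) := by
    have : Continuous fun t : ℂ ↦ 1 - t • a := by fun_prop
    simpa using (this.tendsto 0).mono_left nhdsWithin_le_nhds
  constructor
  · filter_upwards [h0.eventually (Units.isOpen.mem_nhds isUnit_one)] with t ht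
    exact Ring.mul_inverse_cancel _ ht
  · have := (NormedRing.inverse_continuousAt (1 : Aˣ)).tendsto
    rw [Units.val_one, Ring.inverse_one] at this
    exact this.comp h0

open Filter Topology in
lemma map_star (h : IsStarHomAt T 1) (a : A) : T (star a) = star (T a) := by
  obtain ⟨hinv, hlim⟩ := eventually_inverse_one_sub_smul a
  have hcont := h.continuous
  have key : ∀ᶠ t : ℂ in 𝓝[≠] 0,
      star (T (star (a * Ring.inverse (1 - t • a)))) =
        T a + t • (T a * star (T (star (a * Ring.inverse (1 - t • a))))) := by
    filter_upwards [hinv, self_mem_nhdsWithin] with t ht ht0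
    set r := Ring.inverse (1 - t • a)
    have hr : r = 1 + t • (a * r) := by
      rw [sub_mul, one_mul, smul_mul_assoc] at ht
      exact sub_eq_iff_eq_add.1 ht
    have h1 := (h.1 (1 - t • a) (star r) (by simpa using ht)).2
    rw [hr] at h1
    simp only [map_sub, map_add, map_smul, star_add, star_smul, star_one,
      RCLike.star_def, RingHomCompTriple.comp_apply, RingHom.id_apply, h.star_map_one,
      sub_mul, mul_add, mul_smul_comm, smul_mul_assoc, h.map_one_mul_self, h.mul_map_one] at h1
    have h2 : T 1 * star (T (star (a * r))) = star (T (star (a * r))) := by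
      rw [← star_inj, star_mul, star_star, h.star_map_one, h.mul_map_one]
    rw [h2] at h1
    refine smul_right_injective B (ht0 : t ≠ 0) (sub_eq_zero.1 ?_)
    refine Eq.trans ?_ (sub_eq_zero.2 h1)
    module
  have hL : Tendsto (fun t : ℂ ↦ star (T (star (a * Ring.inverse (1 - t • a)))))
      (𝓝[≠] 0) (𝓝 (star (T (star a)))) := by
    have : Continuous fun r : A ↦ star (T (star (a * r))) := by fun_prop
    exact (this.tendsto' 1 _ (by simp)).comp hlim
  have ht : Tendsto (fun t : ℂ ↦ t) (𝓝[≠] 0) (𝓝 0) := nhdsWithin_le_nhds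
  have hR := tendsto_const_nhds (x := T a) |>.add (ht.smul (hL.const_mul (T a)))
  have := tendsto_nhds_unique (hL.congr' key) hR
  rw [zero_smul, add_zero] at this
  rw [← this, star_star]

open Filter Topology in
lemma map_mul_self (h : IsStarHomAt T 1) (a : A) : T (a * a) = T a * T a := by
  obtain ⟨hinv, hlim⟩ := eventually_inverse_one_sub_smul a
  have hcont := h.continuous
  have key : ∀ᶠ t : ℂ in 𝓝[≠] 0,
      T (a * a * Ring.inverse (1 - t • a)) = T a * T (a * Ring.inverse (1 - t • a)) := by
    filter_upwards [hinv, self_mem_nhdsWithin] with t ht ht0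
    set r := Ring.inverse (1 - t • a)
    have hr : r = 1 + t • (a * r) := by
      rw [sub_mul, one_mul, smul_mul_assoc] at ht
      exact sub_eq_iff_eq_add.1 ht
    have har : T (a * r) = T a + t • T (a * a * r) := by
      conv_lhs => rw [hr]
      simp [mul_add, mul_assoc]
    have h1 := (h.1 (1 - t • a) (star r) (by simpa using ht)).2
    rw [h.map_star, star_star, hr] at h1
    simp only [map_sub, map_add, map_smul, sub_mul, mul_add, mul_smul_comm, smul_mul_assoc,
      h.map_one_mul, h.mul_map_one] at h1
    have h2 : T (a * r) = T a + t • (T a * T (a * r)) := by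
      refine smul_right_injective B (ht0 : t ≠ 0) (sub_eq_zero.1 ?_)
      refine Eq.trans ?_ (sub_eq_zero.2 h1)
      module
    exact smul_right_injective B (ht0 : t ≠ 0) (add_left_cancel (har.symm.trans h2))
  have hL : Tendsto (fun t : ℂ ↦ T (a * a * Ring.inverse (1 - t • a))) (𝓝[≠] 0)
      (𝓝 (T (a * a))) := by
    have : Continuous fun r : A ↦ T (a * a * r) := by fun_prop
    exact (this.tendsto' 1 _ (by simp)).comp hlim
  have hR : Tendsto (fun t : ℂ ↦ T a * T (a * Ring.inverse (1 - t • a))) (𝓝[≠] 0)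
      (𝓝 (T a * T a)) := by
    have : Continuous fun r : A ↦ T a * T (a * r) := by fun_prop
    exact (this.tendsto' 1 _ (by simp)).comp hlim
  exact tendsto_nhds_unique (hL.congr' key) hR

lemma map_mul_map_eq_zero (h0 : IsStarHomAt T 0) (h1 : IsStarHomAt T 1) {a b : A}
    (hab : a * b = 0) : T a * T b = 0 := by
  simpa [h1.map_star] using (h0.1 a (star b) (by simpa using hab)).2

end Basic

end IsStarHomAt

/-- The continuous bump `max 0 (min 1 (t + 1)) - max 0 (min 1 t)`, supported in `[-1, 1]`, whose
integer translates form a partition of unity. -/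
noncomputable def unitBump (t : ℝ) : ℝ := max 0 (min 1 (t + 1)) - max 0 (min 1 t)

lemma continuous_unitBump : Continuous unitBump := by
  unfold unitBump; fun_prop

lemma unitBump_nonneg (t : ℝ) : 0 ≤ unitBump t :=
  sub_nonneg.2 (max_le_max le_rfl (min_le_min le_rfl (by linarith)))

lemma unitBump_le_one (t : ℝ) : unitBump t ≤ 1 := by
  have h1 : max 0 (min 1 (t + 1)) ≤ 1 := max_le zero_le_one (min_le_left _ _)
  have h2 : 0 ≤ max 0 (min 1 t) := le_max_left _ _
  unfold unitBump
  linarith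

lemma unitBump_of_one_le_abs {t : ℝ} (ht : 1 ≤ |t|) : unitBump t = 0 := by
  unfold unitBump
  rcases le_abs'.1 ht with h | h
  · rw [max_eq_left ((min_le_right _ _).trans (by linarith)),
      max_eq_left ((min_le_right _ _).trans (by linarith)), sub_zero]
  · rw [min_eq_left (by linarith), min_eq_left h, sub_self]

lemma sum_unitBump {n : ℕ} {t : ℝ} (ht : |t| ≤ n) :
    ∑ i ∈ Finset.range (2 * n + 1), unitBump (t - (i - n)) = 1 := by
  have := Finset.sum_range_sub' (fun i : ℕ ↦ max 0 (min 1 (t - (i - n) + 1))) (2 * n + 1)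
  have ht' := abs_le.1 ht
  calc _ = ∑ i ∈ Finset.range (2 * n + 1), (max 0 (min 1 (t - ((i : ℕ) - n) + 1)) -
        max 0 (min 1 (t - ((i + 1 : ℕ) - n) + 1))) := by
        refine Finset.sum_congr rfl fun i _ ↦ ?_
        unfold unitBump
        congr 3
        push_cast
        ring
    _ = 1 := by
        rw [this, min_eq_left (by push_cast; linarith),
          max_eq_left ((min_le_right _ _).trans (by push_cast; linarith))]
        norm_num

section Localization

variable {A B : Type*} [CStarAlgebra A] [NonUnitalCStarAlgebra B]

/-- A bounded map which is local with respect to `T` satisfies a sublinear growth estimate on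
selfadjoint elements. -/
lemma norm_sq_le_of_local {T W : A →ₗ[ℂ] B} {K M : ℝ} (hK : 0 ≤ K)
    (hTK : ∀ x, ‖T x‖ ≤ K * ‖x‖) (hM : 0 ≤ M) (hWM : ∀ x, ‖W x‖ ≤ M * ‖x‖)
    (hT_star : ∀ x, T (star x) = star (T x)) (hT_sq : ∀ x, T (x * x) = T x * T x)
    (hW_one : W 1 = 0) (hW_mul : ∀ x, W x * T 1 = W x)
    (hW : ∀ x y, x * y = 0 → W x * T y = 0) {a : A} (ha : IsSelfAdjoint a) {n : ℕ}
    (han : ‖a‖ ≤ n) : ‖W a‖ ^ 2 ≤ (2 * n + 1) * (M * K) ^ 2 := by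
  rcases subsingleton_or_nontrivial A
  · rw [Subsingleton.elim a 1, hW_one, norm_zero, zero_pow two_ne_zero]
    positivity
  let g (i : ℕ) (t : ℝ) : ℝ := √(unitBump (t - (i - n)))
  let f (i : ℕ) (t : ℝ) : ℝ := max (-1) (min 1 (t - (i - n)))
  have hg (i : ℕ) : Continuous (g i) := by
    have := continuous_unitBump
    fun_prop
  have hf (i : ℕ) : Continuous (f i) := by fun_prop
  have hsum : ∑ i ∈ Finset.range (2 * n + 1), cfc (g i) a * cfc (g i) a = 1 := by
    rw [← cfc_one ℝ a, ← Finset.sum_congr rfl fun i _ ↦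
      cfc_mul (g i) (g i) a (hg i).continuousOn (hg i).continuousOn,
      ← cfc_sum (fun i t ↦ g i t * g i t) _ _ fun i _ ↦ ((hg i).mul (hg i)).continuousOn]
    refine cfc_congr fun t ht ↦ ?_
    have ht' : |t| ≤ n := (spectrum.norm_le_norm_of_mem ht).trans han
    simp only [Finset.sum_apply, g, Real.mul_self_sqrt (unitBump_nonneg _), sum_unitBump ht',
      Pi.one_apply]
  have hloc (i : ℕ) : ‖W a * T (cfc (g i) a)‖ ≤ M * K := by
    have h1 : (a - algebraMap ℝ A (i - n) - cfc (f i) a) * cfc (g i) a = 0 := by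
      conv_lhs => enter [1, 1]; rw [← cfc_id' ℝ a, ← cfc_const (i - n : ℝ) a]
      rw [← cfc_sub _ _ a, ← cfc_sub _ _ a (by fun_prop) (hf i).continuousOn,
        ← cfc_mul _ _ a (by have := hf i; fun_prop) (hg i).continuousOn, ← cfc_zero ℝ a]
      refine cfc_congr fun t _ ↦ ?_
      rcases le_total 1 |t - (i - n)| with h | h
      · simp [g, unitBump_of_one_le_abs h]
      · rw [abs_le] at h
        simp [f, min_eq_right h.2, max_eq_right h.1]
    have h2 : W a * T (cfc (g i) a) = W (cfc (f i) a) * T (cfc (g i) a) := by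
      have h3 := hW _ _ h1
      rw [Algebra.algebraMap_eq_smul_one, ← Complex.coe_smul, map_sub, map_sub, map_smul, hW_one,
        smul_zero, sub_zero, sub_mul, sub_eq_zero] at h3
      exact h3
    have hfn : ‖cfc (f i) a‖ ≤ 1 := norm_cfc_le zero_le_one fun t _ ↦
      abs_le.2 ⟨le_max_left _ _, max_le (by norm_num) (min_le_left _ _)⟩
    have hgn : ‖cfc (g i) a‖ ≤ 1 := norm_cfc_le zero_le_one fun t _ ↦ by
      rw [Real.norm_of_nonneg (Real.sqrt_nonneg _)]
      exact Real.sqrt_le_one.2 (unitBump_le_one _)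
    rw [h2]
    calc _ ≤ ‖W (cfc (f i) a)‖ * ‖T (cfc (g i) a)‖ := norm_mul_le _ _
      _ ≤ (M * ‖cfc (f i) a‖) * (K * ‖cfc (g i) a‖) := by gcongr <;> apply_assumption
      _ ≤ (M * 1) * (K * 1) := by gcongr
      _ = M * K := by ring
  have hdecomp : W a * star (W a) = ∑ i ∈ Finset.range (2 * n + 1),
      (W a * T (cfc (g i) a)) * star (W a * T (cfc (g i) a)) := by
    conv_lhs => enter [1]; rw [← hW_mul a, ← hsum, map_sum, Finset.mul_sum]
    rw [Finset.sum_mul]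
    refine Finset.sum_congr rfl fun i _ ↦ ?_
    have hsa : star (T (cfc (g i) a)) = T (cfc (g i) a) := by
      rw [← hT_star, (cfc_predicate (g i) a : IsSelfAdjoint _).star_eq]
    rw [star_mul, hsa, hT_sq]
    simp only [mul_assoc]
  calc ‖W a‖ ^ 2 = ‖W a * star (W a)‖ := by rw [CStarRing.norm_self_mul_star, sq]
    _ ≤ ∑ i ∈ Finset.range (2 * n + 1),
        ‖(W a * T (cfc (g i) a)) * star (W a * T (cfc (g i) a))‖ := by
      rw [hdecomp]; exact norm_sum_le _ _
    _ ≤ ∑ i ∈ Finset.range (2 * n + 1), (M * K) ^ 2 := by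
      gcongr with i
      rw [CStarRing.norm_self_mul_star, ← sq]
      gcongr
      exact hloc i
    _ = (2 * n + 1) * (M * K) ^ 2 := by simp

lemma eq_zero_of_local {T W : A →ₗ[ℂ] B} {K M : ℝ} (hK : 0 ≤ K)
    (hTK : ∀ x, ‖T x‖ ≤ K * ‖x‖) (hM : 0 ≤ M) (hWM : ∀ x, ‖W x‖ ≤ M * ‖x‖)
    (hT_star : ∀ x, T (star x) = star (T x)) (hT_sq : ∀ x, T (x * x) = T x * T x)
    (hW_one : W 1 = 0) (hW_mul : ∀ x, W x * T 1 = W x)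
    (hW : ∀ x y, x * y = 0 → W x * T y = 0) : W = 0 := by
  have hsa {a : A} (ha : IsSelfAdjoint a) : W a = 0 := by
    obtain ⟨m, hm⟩ := exists_nat_ge ‖a‖
    by_contra hne
    have hpos : 0 < ‖W a‖ ^ 2 := by positivity
    obtain ⟨k, hk⟩ := exists_nat_gt ((2 * m + 1) * (M * K) ^ 2 / ‖W a‖ ^ 2)
    rw [div_lt_iff₀ hpos] at hk
    have hk0 : (1 : ℝ) ≤ k := by
      rcases k.eq_zero_or_pos with rfl | hk'
      · rw [Nat.cast_zero, zero_mul] at hk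
        exact absurd hk (not_lt.2 (by positivity))
      · exact_mod_cast hk'
    have hka : ‖(k : ℝ) • a‖ ≤ (k * m : ℕ) := by
      rw [norm_smul, Real.norm_natCast, Nat.cast_mul]
      gcongr
    have h1 := norm_sq_le_of_local hK hTK hM hWM hT_star hT_sq hW_one hW_mul hW
      ((IsSelfAdjoint.all (k : ℝ)).smul ha) hka
    rw [← Complex.coe_smul, map_smul, norm_smul, Complex.norm_real, Real.norm_natCast,
      Nat.cast_mul] at h1
    have hC : 0 ≤ (M * K) ^ 2 := sq_nonneg _
    have h2 : (k : ℝ) * (k * ‖W a‖ ^ 2) ≤ k * ((2 * m + 1) * (M * K) ^ 2) := by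
      nlinarith
    exact absurd (le_of_mul_le_mul_left h2 (by linarith)) (not_le.2 hk)
  ext x
  rw [← realPart_add_I_smul_imaginaryPart x, map_add, map_smul, hsa (realPart x).2,
    hsa (imaginaryPart x).2]
  simp

lemma IsStarHomAt.map_mul {T : A →ₗ[ℂ] B} (h0 : IsStarHomAt T 0) (h1 : IsStarHomAt T 1)
    (x y : A) : T (x * y) = T x * T y := by
  let W : A →ₗ[ℂ] B := T ∘ₗ LinearMap.mulLeft ℂ x - LinearMap.mulLeft ℂ (T x) ∘ₗ T
  have hW (z : A) : W z = T (x * z) - T x * T z := rfl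
  set K := 2 * ‖T 1‖
  have hWz : W = 0 := by
    refine eq_zero_of_local (T := T) (K := K) (M := K * ‖x‖ + ‖T x‖ * K) (by positivity)
      h1.norm_map_le (by positivity) (fun z ↦ ?_) h1.map_star h1.map_mul_self ?_ (fun z ↦ ?_)
      fun z w hzw ↦ ?_
    · calc ‖W z‖ ≤ ‖T (x * z)‖ + ‖T x * T z‖ := norm_sub_le _ _
        _ ≤ K * (‖x‖ * ‖z‖) + ‖T x‖ * (K * ‖z‖) := by
          gcongr
          · exact (h1.norm_map_le _).trans (by gcongr; exact norm_mul_le _ _)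
          · exact (norm_mul_le _ _).trans (by gcongr; exact h1.norm_map_le _)
        _ = (K * ‖x‖ + ‖T x‖ * K) * ‖z‖ := by ring
    · rw [hW, mul_one, h1.mul_map_one, sub_self]
    · rw [hW, sub_mul, mul_assoc, h1.mul_map_one, h1.mul_map_one]
    · rw [hW, sub_mul, mul_assoc, h0.map_mul_map_eq_zero h1 hzw,
        h0.map_mul_map_eq_zero h1 (by rw [mul_assoc, hzw, mul_zero]), mul_zero, sub_zero]
  exact sub_eq_zero.1 (DFunLike.congr_fun hWz y)

end Localization

lemma isStarHomAt_of_map_mul_of_map_star {A B : Type*} [Mul A] [Star A] [Mul B] [Star B]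
    {T : A → B} (hmul : ∀ x y, T (x * y) = T x * T y) (hstar : ∀ x, T (star x) = star (T x))
    (z : A) : IsStarHomAt T z := by
  refine ⟨fun a b h ↦ ?_, fun c d h ↦ ?_⟩
  · rw [← h, hmul, hstar]
    exact ⟨rfl, rfl⟩
  · rw [← h, hmul, hstar]
    exact ⟨rfl, rfl⟩

theorem stmt8 {A B : Type*}
    [NormedRing A] [StarRing A] [CStarRing A] [CompleteSpace A]
    [NormedAlgebra ℂ A] [StarModule ℂ A]
    [NonUnitalNormedRing B] [StarRing B] [CStarRing B] [CompleteSpace B]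
    [NormedSpace ℂ B] [IsScalarTower ℂ B B] [SMulCommClass ℂ B B] [StarModule ℂ B]
    (T : A →ₗ[ℂ] B) :
    ((∀ x y : A, T (x * y) = T x * T y) ∧ (∀ x : A, T (star x) = star (T x)))
      ↔ (IsStarHomAt (⇑T) 0 ∧ IsStarHomAt (⇑T) 1) := by
  let _ : CStarAlgebra A := {}
  let _ : NonUnitalCStarAlgebra B := {}
  refine ⟨fun ⟨hmul, hstar⟩ ↦ ⟨isStarHomAt_of_map_mul_of_map_star hmul hstar 0,
    isStarHomAt_of_map_mul_of_map_star hmul hstar 1⟩, fun ⟨h0, h1⟩ ↦ ⟨h0.map_mul h1, h1.map_star⟩⟩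
end

section
/- Let A and B be C*-algebras with A unital, let u be a unitary element of A, and let T : A → B be a bounded linear map which is a *-homomorphism at 0 and a *-homomorphism at u. Then T(1) is a projection in B, T(1) T(a) = T(a) T(1) for every a ∈ A, and the map S(a) = T(1) T(a) is a *-homomorphism: S(xy) = S(x) S(y) and S(x*) = S(x)* for all x, y ∈ A. If moreover T(1) T(x) = T(x) for every x ∈ A, then T itself is a *-homomorphism. -/
/-- The ramp that climbs from `0` to `1` as `f` climbs from `i - 1` to `i`. -/
noncomputable def ramp {K : Type*} [TopologicalSpace K] (f : C(K, ℝ)) (i : ℕ) : C(K, ℝ) where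
  toFun x := max 0 (min 1 (f x - i + 1))

section Ramp

variable {K : Type*} [TopologicalSpace K] (f : C(K, ℝ))

theorem ramp_apply (i : ℕ) (x : K) : ramp f i x = max 0 (min 1 (f x - i + 1)) := rfl

theorem ramp_nonneg (i : ℕ) (x : K) : 0 ≤ ramp f i x := le_max_left _ _

theorem ramp_le_one (i : ℕ) (x : K) : ramp f i x ≤ 1 :=
  max_le zero_le_one (min_le_left _ _)

theorem ramp_antitone (x : K) : Antitone fun i => ramp f i x := by
  intro i j hij
  have : (i : ℝ) ≤ j := by exact_mod_cast hij
  simp only [ramp_apply]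
  gcongr

theorem ramp_mul_one_sub {i j : ℕ} (hij : i < j) : ramp f j * (1 - ramp f i) = 0 := by
  ext x
  have hij' : (i : ℝ) + 1 ≤ j := by exact_mod_cast hij
  simp only [ContinuousMap.mul_apply, ContinuousMap.sub_apply, ContinuousMap.one_apply,
    ContinuousMap.zero_apply, mul_eq_zero, ramp_apply]
  rcases le_total (f x - j + 1) 0 with h | h
  · left
    exact max_eq_left ((min_le_right _ _).trans h)
  · right
    rw [min_eq_left (by linarith), max_eq_right zero_le_one, sub_self]

theorem sum_ramp (hf : ∀ x, 0 ≤ f x) (n : ℕ) (x : K) :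
    ∑ i ∈ Finset.range n, ramp f (i + 1) x = min (f x) n := by
  induction n with
  | zero => simp [hf x]
  | succ n ih =>
    rw [Finset.sum_range_succ, ih, ramp_apply]
    push_cast
    rcases le_total (f x) n with h | h
    · rw [min_eq_left h, min_eq_right (by linarith), max_eq_left (by linarith),
        min_eq_left (by linarith), add_zero]
    · rw [min_eq_right h, max_eq_right (le_min zero_le_one (by linarith))]
      rcases le_total (f x) (n + 1) with h' | h'
      · rw [min_eq_left h', min_eq_right (by linarith)]; ring
      · rw [min_eq_right h', min_eq_left (by linarith)]

/-- The tent function obtained as the difference of two consecutive ramps. -/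
noncomputable def tent (i : ℕ) : C(K, ℝ) := ramp f i - ramp f (i + 1)

theorem tent_mul_tent {i j : ℕ} (hij : i + 2 ≤ j) : tent f i * tent f j = 0 := by
  have h1 := ramp_mul_one_sub f (show i < j by omega)
  have h2 := ramp_mul_one_sub f (show i < j + 1 by omega)
  have h3 := ramp_mul_one_sub f (show i + 1 < j by omega)
  have h4 := ramp_mul_one_sub f (show i + 1 < j + 1 by omega)
  unfold tent
  linear_combination h3 - h1 + h2 - h4

theorem tent_mul_tent' {i j : ℕ} (hij : i + 2 ≤ j) : tent f j * tent f i = 0 := by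
  rw [mul_comm, tent_mul_tent f hij]

theorem tent_nonneg (i : ℕ) (x : K) : 0 ≤ tent f i x :=
  sub_nonneg.2 (ramp_antitone f x i.le_succ)

theorem norm_sum_tent_le [CompactSpace K] (s m : ℕ) :
    ‖∑ k ∈ Finset.range m, tent f (3 * k + s)‖ ≤ 1 := by
  rw [ContinuousMap.norm_le _ zero_le_one]
  intro x
  rw [ContinuousMap.sum_apply, Real.norm_of_nonneg (Finset.sum_nonneg fun _ _ => tent_nonneg f _ x)]
  have key : ∑ k ∈ Finset.range m, tent f (3 * k + s) x ≤ ramp f s x - ramp f (3 * m + s) x := by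
    induction m with
    | zero => simp
    | succ m ih =>
      rw [Finset.sum_range_succ]
      have := ramp_antitone f x (show 3 * m + s + 1 ≤ 3 * (m + 1) + s by omega)
      simp only [tent, ContinuousMap.sub_apply] at this ih ⊢
      linarith
  linarith [ramp_le_one f s x, ramp_nonneg f (3 * m + s) x]

end Ramp

theorem sum_range_three_mul {E : Type*} [AddCommMonoid E] (a : ℕ → E) (m : ℕ) :
    ∑ i ∈ Finset.range (3 * m), a i =
      ∑ k ∈ Finset.range m, a (3 * k) + ∑ k ∈ Finset.range m, a (3 * k + 1) +
        ∑ k ∈ Finset.range m, a (3 * k + 2) := by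
  induction m with
  | zero => simp
  | succ m ih =>
    rw [show 3 * (m + 1) = 3 * m + 1 + 1 + 1 by ring]
    simp only [Finset.sum_range_succ]
    rw [ih]
    abel

section Bilinear

variable {K : Type*} [TopologicalSpace K]
  {E : Type*} [NormedAddCommGroup E] [NormedSpace ℝ E]

theorem apply_ramp_one_sub_ramp (Φ : C(K, ℝ) →ₗ[ℝ] C(K, ℝ) →ₗ[ℝ] E)
    (hΦ : ∀ f g, f * g = 0 → Φ f g = 0) (f : C(K, ℝ)) (i : ℕ) :
    Φ (ramp f (i + 1)) (1 - ramp f (i + 1)) = Φ (tent f (i + 1)) (tent f i) := by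
  have h1 := hΦ _ _ (ramp_mul_one_sub f (show i + 1 < i + 1 + 1 by omega))
  have h2 := hΦ _ _ (ramp_mul_one_sub f (show i < i + 1 by omega))
  have h3 := hΦ _ _ (ramp_mul_one_sub f (show i < i + 1 + 1 by omega))
  simp only [tent, map_sub, LinearMap.sub_apply] at *
  rw [sub_eq_zero] at h1 h2 h3
  rw [← h1, ← h2, ← h3]
  abel

variable [CompactSpace K]

theorem norm_sum_apply_ramp_one_sub_ramp_le (Φ : C(K, ℝ) →ₗ[ℝ] C(K, ℝ) →ₗ[ℝ] E) {C : ℝ}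
    (hC : 0 ≤ C) (hb : ∀ f g, ‖Φ f g‖ ≤ C * ‖f‖ * ‖g‖)
    (hΦ : ∀ f g, f * g = 0 → Φ f g = 0) (f : C(K, ℝ)) (m : ℕ) :
    ‖∑ i ∈ Finset.range (3 * m), Φ (ramp f (i + 1)) (1 - ramp f (i + 1))‖ ≤ 3 * C := by
  have hdiag (r : ℕ) : ∑ k ∈ Finset.range m, Φ (tent f (3 * k + (r + 1))) (tent f (3 * k + r)) =
      Φ (∑ k ∈ Finset.range m, tent f (3 * k + (r + 1)))
        (∑ k ∈ Finset.range m, tent f (3 * k + r)) := by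
    simp only [map_sum, LinearMap.sum_apply]
    refine Finset.sum_congr rfl fun k hk => ?_
    rw [Finset.sum_eq_single_of_mem k hk]
    intro l _ hl
    refine hΦ _ _ ?_
    rcases lt_or_gt_of_ne hl with h | h
    · exact tent_mul_tent f (by omega)
    · exact tent_mul_tent' f (by omega)
  have hclass (r : ℕ) :
      ‖∑ k ∈ Finset.range m, Φ (tent f (3 * k + (r + 1))) (tent f (3 * k + r))‖ ≤ C := by
    rw [hdiag]
    calc _ ≤ C * _ * _ := hb _ _
      _ ≤ C * 1 * 1 := by
        gcongr
        · exact norm_sum_tent_le f _ m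
        · exact norm_sum_tent_le f _ m
      _ = C := by ring
  simp only [apply_ramp_one_sub_ramp Φ hΦ]
  rw [sum_range_three_mul]
  calc _ ≤ C + C + C :=
        norm_add_le_of_le (norm_add_le_of_le (hclass 0) (hclass 1)) (hclass 2)
    _ = 3 * C := by ring

/-- A bounded bilinear map on `C(K, ℝ)` vanishing on pairs with zero product satisfies
`Φ f 1 = Φ 1 f`. -/
theorem bilin_apply_one_eq (Φ : C(K, ℝ) →ₗ[ℝ] C(K, ℝ) →ₗ[ℝ] E) {C : ℝ}
    (hC : 0 ≤ C) (hb : ∀ f g, ‖Φ f g‖ ≤ C * ‖f‖ * ‖g‖)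
    (hΦ : ∀ f g, f * g = 0 → Φ f g = 0) (f : C(K, ℝ)) : Φ f 1 = Φ 1 f := by
  have unit_case (f : C(K, ℝ)) (h0 : ∀ x, 0 ≤ f x) (h1 : ∀ x, f x ≤ 1) : Φ f 1 = Φ 1 f := by
    have hm (m : ℕ) : ‖(m : ℝ) • (Φ f 1 - Φ 1 f)‖ ≤ 2 * C := by
      set F : C(K, ℝ) := ((3 * m : ℕ) : ℝ) • f with hF
      have hsum : F = ∑ i ∈ Finset.range (3 * m), ramp F (i + 1) := by
        ext x
        rw [ContinuousMap.sum_apply, sum_ramp, min_eq_left]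
        · exact mul_le_of_le_one_right (Nat.cast_nonneg _) (h1 x)
        · exact fun x => mul_nonneg (Nat.cast_nonneg _) (h0 x)
      have hdiff : Φ F 1 - Φ 1 F =
          ∑ i ∈ Finset.range (3 * m), Φ (ramp F (i + 1)) (1 - ramp F (i + 1)) -
          ∑ i ∈ Finset.range (3 * m), Φ.flip (ramp F (i + 1)) (1 - ramp F (i + 1)) := by
        conv_lhs => rw [hsum]
        simp only [map_sum, LinearMap.sum_apply, ← Finset.sum_sub_distrib]
        refine Finset.sum_congr rfl fun i _ => ?_
        simp only [LinearMap.flip_apply, map_sub]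
        abel
      have h3 : ‖Φ F 1 - Φ 1 F‖ ≤ 3 * C + 3 * C := by
        rw [hdiff]
        refine norm_sub_le_of_le (norm_sum_apply_ramp_one_sub_ramp_le Φ hC hb hΦ F m)
          (norm_sum_apply_ramp_one_sub_ramp_le Φ.flip hC (fun f g => ?_) (fun f g hfg => ?_) F m)
        · exact (hb g f).trans_eq (by ring)
        · exact hΦ g f (by rw [mul_comm, hfg])
      have h4 : Φ F 1 - Φ 1 F = (3 : ℝ) • (m : ℝ) • (Φ f 1 - Φ 1 f) := by
        rw [hF, map_smul, map_smul, LinearMap.smul_apply, ← smul_sub, smul_smul]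
        push_cast
        rfl
      rw [h4, norm_smul, Real.norm_of_nonneg (by norm_num : (0 : ℝ) ≤ 3)] at h3
      linarith
    rw [← sub_eq_zero, ← norm_eq_zero]
    by_contra hne
    have hpos := lt_of_le_of_ne (norm_nonneg (Φ f 1 - Φ 1 f)) (Ne.symm hne)
    obtain ⟨m, hlt⟩ := exists_nat_gt (2 * C / ‖Φ f 1 - Φ 1 f‖)
    rw [div_lt_iff₀ hpos] at hlt
    have := hm m
    rw [norm_smul, Real.norm_natCast] at this
    linarith
  set M : ℝ := ‖f‖ + 1 with hM
  have hMpos : 0 < M := by positivity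
  have hfx (x : K) : |f x| ≤ M := (f.norm_coe_le_norm x).trans (by linarith)
  have hg := unit_case ((2 * M)⁻¹ • (f + M • (1 : C(K, ℝ))))
    (fun x => by
      have := abs_le.1 (hfx x)
      simp only [ContinuousMap.smul_apply, ContinuousMap.add_apply, ContinuousMap.one_apply,
        smul_eq_mul, mul_one]
      exact mul_nonneg (by positivity) (by linarith))
    (fun x => by
      have := abs_le.1 (hfx x)
      simp only [ContinuousMap.smul_apply, ContinuousMap.add_apply, ContinuousMap.one_apply,
        smul_eq_mul, mul_one]
      rw [inv_mul_le_iff₀ (by positivity)]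
      linarith)
  simp only [map_smul, map_add, LinearMap.smul_apply, LinearMap.add_apply] at hg
  exact add_right_cancel (smul_right_injective E (by positivity : (2 * M)⁻¹ ≠ 0) hg)

end Bilinear

section CStar

variable {A : Type*} [CStarAlgebra A] {E : Type*} [NormedAddCommGroup E] [NormedSpace ℂ E]

/-- On a unital C⋆-algebra, a bounded bilinear map vanishing on pairs with zero product
is balanced. -/
theorem bilin_mul_apply_eq (V : A →ₗ[ℂ] A →ₗ[ℂ] E) {C : ℝ}
    (hC : 0 ≤ C) (hb : ∀ a b, ‖V a b‖ ≤ C * ‖a‖ * ‖b‖)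
    (hV : ∀ a b, a * b = 0 → V a b = 0) (a h c : A) : V (a * h) c = V a (h * c) := by
  have sa_case (h : A) (hh : IsSelfAdjoint h) : V (a * h) c = V a (h * c) := by
    let π := cfcHom (R := ℝ) hh
    have hπ (f : C(spectrum ℝ h, ℝ)) : ‖π f‖ = ‖f‖ := norm_cfcHom (𝕜 := ℝ) h f hh
    let Φ : C(spectrum ℝ h, ℝ) →ₗ[ℝ] C(spectrum ℝ h, ℝ) →ₗ[ℝ] E :=
      LinearMap.mk₂ ℝ (fun f g => V (a * π f) (π g * c))
        (fun f f' g => by simp [mul_add])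
        (fun r f g => by
          rw [map_smul, mul_smul_comm, ← Complex.coe_smul, map_smul, LinearMap.smul_apply,
            Complex.coe_smul])
        (fun f g g' => by simp [add_mul])
        (fun r f g => by
          rw [map_smul, smul_mul_assoc, ← Complex.coe_smul, map_smul, Complex.coe_smul])
    have key := bilin_apply_one_eq Φ (C := C * ‖a‖ * ‖c‖) (by positivity)
      (fun f g => by
        calc ‖V (a * π f) (π g * c)‖ ≤ C * ‖a * π f‖ * ‖π g * c‖ := hb _ _
          _ ≤ C * (‖a‖ * ‖π f‖) * (‖π g‖ * ‖c‖) := by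
            gcongr <;> exact norm_mul_le _ _
          _ = _ := by rw [hπ, hπ]; ring)
      (fun f g hfg => hV _ _ (by
        rw [mul_assoc, ← mul_assoc (π f), ← map_mul, hfg, map_zero, zero_mul, mul_zero]))
      (.restrict (spectrum ℝ h) (.id ℝ))
    have hid : π (.restrict (spectrum ℝ h) (.id ℝ)) = h := cfcHom_id hh
    simpa [Φ, hid] using key
  rw [← realPart_add_I_smul_imaginaryPart h]
  simp only [mul_add, add_mul, map_add, LinearMap.add_apply, mul_smul_comm, smul_mul_assoc,
    map_smul, LinearMap.smul_apply, sa_case _ (realPart h).2, sa_case _ (imaginaryPart h).2]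

end CStar

section StarHomAt

variable {A B : Type*} [CStarAlgebra A]
  [NonUnitalNormedRing B] [StarRing B] [CStarRing B]
  [NormedSpace ℂ B] [IsScalarTower ℂ B B] [SMulCommClass ℂ B B] [StarModule ℂ B]

theorem map_mul_star_map_star_mul (T : A →L[ℂ] B)
    (h : ∀ a b : A, a * star b = 0 → T a * star (T b) = 0) (a b c : A) :
    T (a * b) * star (T (star c)) = T a * star (T (star (b * c))) := by
  let V : A →ₗ[ℂ] A →ₗ[ℂ] B :=
    LinearMap.mk₂ ℂ (fun a b => T a * star (T (star b)))
      (fun a a' b => by simp [add_mul])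
      (fun r a b => by simp [smul_mul_assoc])
      (fun a b b' => by simp [mul_add])
      (fun r a b => by simp [mul_smul_comm])
  refine bilin_mul_apply_eq V (C := ‖T‖ * ‖T‖) (by positivity) (fun a b => ?_)
    (fun a b hab => h _ _ (by rwa [star_star])) a b c
  calc ‖T a * star (T (star b))‖ ≤ ‖T a‖ * ‖T (star b)‖ := by
        simpa using norm_mul_le (T a) (star (T (star b)))
    _ ≤ (‖T‖ * ‖a‖) * (‖T‖ * ‖star b‖) := by gcongr <;> exact T.le_opNorm _
    _ = _ := by rw [norm_star]; ring

theorem star_map_star_mul_mul_map (T : A →L[ℂ] B)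
    (h : ∀ a b : A, star a * b = 0 → star (T a) * T b = 0) (a b c : A) :
    star (T (star (a * b))) * T c = star (T (star a)) * T (b * c) := by
  let V : A →ₗ[ℂ] A →ₗ[ℂ] B :=
    LinearMap.mk₂ ℂ (fun a b => star (T (star a)) * T b)
      (fun a a' b => by simp [add_mul])
      (fun r a b => by simp [smul_mul_assoc])
      (fun a b b' => by simp [mul_add])
      (fun r a b => by simp [mul_smul_comm])
  refine bilin_mul_apply_eq V (C := ‖T‖ * ‖T‖) (by positivity) (fun a b => ?_)
    (fun a b hab => h _ _ (by rwa [star_star])) a b c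
  calc ‖star (T (star a)) * T b‖ ≤ ‖T (star a)‖ * ‖T b‖ := by
        simpa using norm_mul_le (star (T (star a))) (T b)
    _ ≤ (‖T‖ * ‖star a‖) * (‖T‖ * ‖b‖) := by gcongr <;> exact T.le_opNorm _
    _ = _ := by rw [norm_star]; ring

end StarHomAt

/-- In a C⋆-ring, `e` is a projection as soon as some `v` with `v * star v = e * star e` and
`star v * v = star e * e` is fixed by `star e` on both sides. -/
theorem eq_star_mul_self_of_fixed {B : Type*} [NonUnitalNormedRing B] [StarRing B] [CStarRing B]
    {e v : B} (hl : star e * v = v) (hr : v * star e = v)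
    (h1 : e * star e = v * star v) (h2 : star e * e = star v * v) : e = star e * e := by
  have a1 : star e * (e * star e) = e * star e := by rw [h1, ← mul_assoc, hl]
  have a2 : star e * (e * star e) = star e * e := by
    rw [← mul_assoc, h2, mul_assoc, hr]
  have a3 : e * star e = star e * e := a1.symm.trans a2
  have b1 : star e * (star e * e) = star e * e := by rw [← a3, a1]
  have b2 : star e * e * e = star e * e := by
    simpa [mul_assoc] using congrArg star b1
  have b3 : star e * e * star e = star e * e := by rw [mul_assoc, a2]
  have b5 : star e * e * (star e * e) = star e * e := by rw [← mul_assoc, b3, b2]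
  rw [← sub_eq_zero, ← CStarRing.star_mul_self_eq_zero_iff]
  rw [star_sub, star_mul, star_star, sub_mul, mul_sub, mul_sub, b1, b2, b5, sub_self]

theorem stmt17 {A B : Type*}
    [NormedRing A] [StarRing A] [CStarRing A] [CompleteSpace A]
    [NormedAlgebra ℂ A] [StarModule ℂ A]
    [NonUnitalNormedRing B] [StarRing B] [CStarRing B] [CompleteSpace B]
    [NormedSpace ℂ B] [IsScalarTower ℂ B B] [SMulCommClass ℂ B B] [StarModule ℂ B]
    (u : A) (hu1 : u * star u = 1) (hu2 : star u * u = 1)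
    (T : A →L[ℂ] B)
    (h0 : IsStarHomAt (⇑T) 0) (hu : IsStarHomAt (⇑T) u) :
    (star (T 1) = T 1 ∧ T 1 * T 1 = T 1) ∧
    (∀ a : A, T 1 * T a = T a * T 1) ∧
    (∀ x y : A, T 1 * T (x * y) = (T 1 * T x) * (T 1 * T y)) ∧
    (∀ x : A, T 1 * T (star x) = star (T 1 * T x)) ∧
    ((∀ x : A, T 1 * T x = T x) →
      (∀ x y : A, T (x * y) = T x * T y) ∧ (∀ x : A, T (star x) = star (T x))) := by
  let _ : CStarAlgebra A := { }
  have hV := map_mul_star_map_star_mul T fun a b hab => by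
    simpa using (h0.1 a b hab).2
  have hW := star_map_star_mul_mul_map T fun a b hab => by
    simpa using (h0.2 a b hab).2
  have hl : star (T 1) * T u = T u := (hu.2 1 u (by simp)).2
  have hr : T u * star (T 1) = T u := (hu.1 u 1 (by simp)).2
  have hp : T 1 = star (T 1) * T 1 :=
    eq_star_mul_self_of_fixed hl hr
      (by simpa [hu1] using hV u (star u) 1)
      (by simpa [hu2] using (hW 1 (star u) u).symm)
  have he : star (T 1) = T 1 := by rw [hp, star_mul, star_star]
  have hee : T 1 * T 1 = T 1 := by
    conv_rhs => rw [hp]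
    rw [he]
  have hV1 (a : A) : T a * T 1 = T 1 * star (T (star a)) := by
    simpa [he] using hV 1 a 1
  have hW1 (a : A) : star (T (star a)) * T 1 = T 1 * T a := by
    simpa [he] using hW 1 a 1
  have hcomm (a : A) : T 1 * T a = T a * T 1 := by
    calc T 1 * T a = T 1 * T a * T 1 := by rw [← hW1, mul_assoc, hee]
      _ = T a * T 1 := by rw [mul_assoc, hV1, ← mul_assoc, hee]
  have hmul (x y : A) : T 1 * T (x * y) = (T 1 * T x) * (T 1 * T y) := by
    have hxy : T 1 * T (x * y) = star (T (star x)) * T y := by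
      simpa [he] using (hW 1 x y).symm
    calc T 1 * T (x * y) = T 1 * (T 1 * T (x * y)) := by rw [← mul_assoc, hee]
      _ = T x * T 1 * T y := by rw [hxy, ← mul_assoc, ← hV1]
      _ = (T 1 * T x) * (T 1 * T y) := by
        rw [hcomm x, mul_assoc, mul_assoc, ← mul_assoc (T 1) (T 1), hee]
  have hstar (x : A) : T 1 * T (star x) = star (T 1 * T x) := by
    rw [star_mul, he, ← hW1, star_star]
  refine ⟨⟨he, hee⟩, hcomm, hmul, hstar, fun h => ⟨fun x y => ?_, fun x => ?_⟩⟩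
  · simpa only [h] using hmul x y
  · simpa only [h] using hstar x
end
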